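/- Let S = {1,…,n} and let (S,φ) be an exchangeable interaction such that the commutative semigroup M(S,φ) is cancellative and power-cancellative. Then (S,φ) is irreducibly quantified. -/

import Mathlib

/-- A conserved quantity of the interaction `(S, φ)`. -/
def IsConserved {S : Type} (φ : S × S → S × S → Prop) (ξ : S → ℝ) : Prop :=
  ∀ s t s' t' : S, φ (s, t) (s', t') → ξ s + ξ t = ξ s' + ξ t'

/-- The relation `Φ_E` on the configuration space `S^X`. -/
def PhiE {S X : Type} (φ : S × S → S × S → Prop) (E : X → X → Prop)
    (η η' : X → S) : Prop :=
  ∃ x y : X, E x y ∧ φ (η x, η y) (η' x, η' y) ∧ ∀ z : X, z ≠ x → z ≠ y → η z = η' z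

/-- Connectivity of the digraph `(X, E)`. -/
def IsConnectedDigraph {X : Type} (E : X → X → Prop) : Prop :=
  Nonempty X ∧ ∀ x y : X, Relation.ReflTransGen E x y

/-- The interaction `(S, φ)` is irreducibly quantified. -/
def IrreduciblyQuantified {S : Type} [Fintype S] (φ : S × S → S × S → Prop) : Prop :=
  ∀ (X : Type) [Fintype X] (E : X → X → Prop),
    Symmetric E → Irreflexive E → IsConnectedDigraph E →
    ∀ η η' : X → S,
      (∀ ξ : S → ℝ, IsConserved φ ξ → ∑ x, ξ (η x) = ∑ x, ξ (η' x)) →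
      Relation.EqvGen (PhiE φ E) η η'

/-- The interaction `(S, φ)` is exchangeable: `(s, t)` and `(t, s)` lie in the same
connected component of the digraph `(S × S, φ)`. -/
def Exchangeable {S : Type} (φ : S × S → S × S → Prop) : Prop :=
  ∀ s t : S, Relation.EqvGen φ (s, t) (t, s)

/-- The defining relations `a_i a_j = a_k a_l` for `((i,j),(k,l)) ∈ φ` of the semigroup
`M(S, φ)`. -/
def interactionRel {n : ℕ} (φ : (Fin n × Fin n) → (Fin n × Fin n) → Prop) :
    FreeSemigroup (Fin n) → FreeSemigroup (Fin n) → Prop := fun w w' =>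
  ∃ i j k l : Fin n, φ (i, j) (k, l) ∧
    w = FreeSemigroup.of i * FreeSemigroup.of j ∧
    w' = FreeSemigroup.of k * FreeSemigroup.of l

/-- The congruence on the free semigroup generated by the defining relations. -/
def interactionCon {n : ℕ} (φ : (Fin n × Fin n) → (Fin n × Fin n) → Prop) :
    Con (FreeSemigroup (Fin n)) :=
  conGen (interactionRel φ)

/-- The semigroup `M(S, φ)` associated to the interaction `(S, φ)`, i.e. the quotient of the
free semigroup on `a_1, …, a_n` by the congruence generated by the relations
`a_i a_j = a_k a_l` for `((i,j),(k,l)) ∈ φ`. -/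
abbrev InteractionSemigroup {n : ℕ} (φ : (Fin n × Fin n) → (Fin n × Fin n) → Prop) :=
  (interactionCon φ).Quotient

/-- The generator `a_i` of `M(S, φ)`. -/
def genM {n : ℕ} (φ : (Fin n × Fin n) → (Fin n × Fin n) → Prop) (i : Fin n) :
    InteractionSemigroup φ :=
  ((FreeSemigroup.of i : FreeSemigroup (Fin n)) : InteractionSemigroup φ)

/-- `spow a N = a ^ (N + 1)` in a semigroup, so that `spow a N` for `N : ℕ` ranges over all
positive powers of `a`. -/
def spow {α : Type} [Semigroup α] (a : α) : ℕ → α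
  | 0 => a
  | N + 1 => spow a N * a

open Relation

section Cancellative

variable {S M : Type*} [CommSemigroup M]

/-- The value of a multiset of letters in `WithOne M`, each letter `i` being sent to `gen i`. -/
def multisetEval (gen : S → M) (a : Multiset S) : WithOne M :=
  (a.map fun i => (gen i : WithOne M)).prod

lemma multisetEval_add (gen : S → M) (a b : Multiset S) :
    multisetEval gen (a + b) = multisetEval gen a * multisetEval gen b := by
  simp [multisetEval]

lemma multisetEval_nsmul (gen : S → M) (k : ℕ) (a : Multiset S) :
    multisetEval gen (k • a) = multisetEval gen a ^ k := by
  simp [multisetEval, Multiset.map_nsmul, Multiset.prod_nsmul]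

/-- The vector of multiplicities of a multiset, with rational entries. -/
noncomputable def countVector (a : Multiset S) : S →₀ ℚ :=
  (a.map fun i => Finsupp.single i (1 : ℚ)).sum

lemma countVector_add (a b : Multiset S) :
    countVector (a + b) = countVector a + countVector b := by
  simp [countVector]

lemma countVector_nsmul (k : ℕ) (a : Multiset S) :
    countVector (k • a) = k • countVector a := by
  simp [countVector, Multiset.map_nsmul, Multiset.sum_nsmul]

lemma countVector_injective : Function.Injective (countVector (S := S)) := by
  classical
  have key (a : Multiset S) (i : S) : countVector a i = a.count i := by
    induction a using Multiset.induction_on with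
    | empty => simp [countVector]
    | cons j a ih =>
      have hcons : countVector (j ::ₘ a) = Finsupp.single j 1 + countVector a := by
        simp [countVector]
      rw [hcons, Finsupp.add_apply, ih, Multiset.count_cons, Finsupp.single_apply]
      by_cases h : i = j
      · simp [h, add_comm]
      · simp [h, Ne.symm h]
  intro a b h
  ext i
  have := DFunLike.congr_fun h i
  rw [key, key] at this
  exact_mod_cast this

lemma linearMap_countVector (f : (S →₀ ℚ) →ₗ[ℚ] ℚ) (a : Multiset S) :
    f (countVector a) = (a.map fun i => f (Finsupp.single i 1)).sum := by
  simp [countVector, map_multiset_sum]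

/-- The differences of multiplicity vectors of multisets with the same value. -/
def relationSubgroup (gen : S → M) : AddSubgroup (S →₀ ℚ) where
  carrier := {x | ∃ a b : Multiset S, multisetEval gen a = multisetEval gen b ∧
    x = countVector a - countVector b}
  zero_mem' := ⟨0, 0, rfl, by simp⟩
  add_mem' := by
    rintro _ _ ⟨a, b, h, rfl⟩ ⟨c, d, h', rfl⟩
    refine ⟨a + c, b + d, by rw [multisetEval_add, multisetEval_add, h, h'], ?_⟩
    rw [countVector_add, countVector_add]
    abel
  neg_mem' := by
    rintro _ ⟨a, b, h, rfl⟩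
    exact ⟨b, a, h.symm, by abel⟩

/-- A vector in the rational span of a subgroup has a positive multiple in the subgroup. -/
lemma exists_nsmul_mem_of_mem_span {V : Type*} [AddCommGroup V] [Module ℚ V] (H : AddSubgroup V)
    {x : V} (hx : x ∈ Submodule.span ℚ (H : Set V)) : ∃ N : ℕ, (N + 1) • x ∈ H := by
  induction hx using Submodule.span_induction with
  | mem x hx => exact ⟨0, by simpa using hx⟩
  | zero => exact ⟨0, by simp⟩
  | add x y _ _ hx hy =>
    obtain ⟨N, hN⟩ := hx
    obtain ⟨K, hK⟩ := hy
    refine ⟨N * K + N + K, ?_⟩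
    have h : (N * K + N + K + 1) • (x + y) = (K + 1) • (N + 1) • x + (N + 1) • (K + 1) • y := by
      module
    rw [h]
    exact H.add_mem (H.nsmul_mem hN _) (H.nsmul_mem hK _)
  | smul q x _ hx =>
    obtain ⟨N, hN⟩ := hx
    refine ⟨(N + 1) * q.den - 1, ?_⟩
    have hden : 1 ≤ (N + 1) * q.den := Nat.mul_pos N.succ_pos q.den_pos
    have h : ((N + 1) * q.den) • q • x = q.num • (N + 1) • x := by
      rw [← Nat.cast_smul_eq_nsmul ℚ, ← Nat.cast_smul_eq_nsmul ℚ, ← Int.cast_smul_eq_zsmul ℚ,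
        smul_smul, smul_smul]
      congr 1
      have := Rat.mul_den_eq_num q
      push_cast
      linear_combination ((N : ℚ) + 1) * this
    rw [Nat.sub_add_cancel hden, h]
    exact H.zsmul_mem hN _

lemma withOne_mul_right_cancel (hcanc : ∀ a b c : M, c * a = c * b → a = b) {a b : M}
    {c : WithOne M} (h : (a : WithOne M) * c = b * c) : a = b := by
  rcases c with _ | c
  · exact WithOne.coe_inj.mp h
  · refine hcanc a b c ?_
    rw [mul_comm c, mul_comm c]
    exact WithOne.coe_inj.mp h

lemma coe_spow {M : Type} [CommSemigroup M] (a : M) (N : ℕ) :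
    ((spow a N : M) : WithOne M) = (a : WithOne M) ^ (N + 1) := by
  induction N with
  | zero => simp [spow]
  | succ N ih => rw [spow, WithOne.coe_mul, ih, ← pow_succ]

lemma eq_of_sub_mem_relationSubgroup (hcanc : ∀ a b c : M, c * a = c * b → a = b) (gen : S → M)
    {a b : Multiset S} {x y : M} (hx : multisetEval gen a = x) (hy : multisetEval gen b = y)
    (h : countVector a - countVector b ∈ relationSubgroup gen) : x = y := by
  obtain ⟨c, d, hcd, h⟩ := h
  have had : a + d = b + c := countVector_injective <| by
    rw [countVector_add, countVector_add, ← sub_eq_zero]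
    rw [← sub_eq_zero] at h
    rw [← h]
    abel
  have := congrArg (multisetEval gen) had
  rw [multisetEval_add, multisetEval_add, hcd, hx, hy] at this
  exact withOne_mul_right_cancel hcanc this

/-- In a cancellative and power-cancellative commutative semigroup, two products of letters that
are not separated by the rational-valued additive invariants are equal. -/
lemma eq_of_forall_invariant {M : Type} [CommSemigroup M]
    (hcanc : ∀ a b c : M, c * a = c * b → a = b)
    (hpow : ∀ (a b : M) (N : ℕ), spow a N = spow b N → a = b) (gen : S → M)
    {a b : Multiset S} {x y : M} (hx : multisetEval gen a = x) (hy : multisetEval gen b = y)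
    (h : ∀ ξ : S → ℚ, (∀ c d : Multiset S, multisetEval gen c = multisetEval gen d →
      (c.map ξ).sum = (d.map ξ).sum) → (a.map ξ).sum = (b.map ξ).sum) : x = y := by
  have hmem : countVector a - countVector b ∈
      Submodule.span ℚ (relationSubgroup gen : Set (S →₀ ℚ)) := by
    by_contra hn
    obtain ⟨f, hf, hle⟩ := Submodule.exists_le_ker_of_notMem hn
    refine hf ?_
    rw [map_sub, linearMap_countVector, linearMap_countVector, sub_eq_zero]
    refine h _ fun c d hcd => ?_
    have hker := hle (Submodule.subset_span ⟨c, d, hcd, rfl⟩)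
    rwa [LinearMap.mem_ker, map_sub, linearMap_countVector, linearMap_countVector,
      sub_eq_zero] at hker
  obtain ⟨N, hN⟩ := exists_nsmul_mem_of_mem_span _ hmem
  rw [smul_sub, ← countVector_nsmul, ← countVector_nsmul] at hN
  refine hpow x y N (eq_of_sub_mem_relationSubgroup hcanc gen ?_ ?_ hN)
  · rw [multisetEval_nsmul, hx, coe_spow]
  · rw [multisetEval_nsmul, hy, coe_spow]

end Cancellative

section Letters

variable {S : Type*}

/-- The multiset of letters of a word. -/
def letters : FreeSemigroup S →ₙ* Multiplicative (Multiset S) :=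
  FreeSemigroup.lift fun i => Multiplicative.ofAdd {i}

lemma letters_of (i : S) : (letters (FreeSemigroup.of i)).toAdd = {i} := by
  simp [letters]

lemma letters_mul (v w : FreeSemigroup S) :
    (letters (v * w)).toAdd = (letters v).toAdd + (letters w).toAdd := by
  simp

lemma exists_letters_eq {a : Multiset S} (ha : a ≠ 0) :
    ∃ w : FreeSemigroup S, (letters w).toAdd = a := by
  induction a using Multiset.induction_on with
  | empty => exact absurd rfl ha
  | cons i a ih =>
    by_cases h : a = 0
    · exact ⟨FreeSemigroup.of i, by rw [letters_of, h]; rfl⟩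
    · obtain ⟨w, hw⟩ := ih h
      exact ⟨FreeSemigroup.of i * w, by rw [letters_mul, letters_of, hw, Multiset.singleton_add]⟩

end Letters

section Configurations

variable {S X : Type} {φ : S × S → S × S → Prop} {E : X → X → Prop}

lemma eqvGen_update_of_eqvGen [DecidableEq X] {x y : X} (hxy : E x y) (hne : x ≠ y) (η : X → S)
    {p q : S × S} (h : EqvGen φ p q) :
    EqvGen (PhiE φ E) (Function.update (Function.update η x p.1) y p.2)
      (Function.update (Function.update η x q.1) y q.2) := by
  induction h with
  | rel p q h =>
    refine EqvGen.rel _ _ ⟨x, y, hxy, by simpa [hne] using h, fun z hzx hzy => ?_⟩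
    simp [hzx, hzy]
  | refl p => exact EqvGen.refl _
  | symm p q _ ih => exact ih.symm
  | trans p q r _ _ ih ih' => exact ih.trans _ _ _ ih'

/-- The permutations of the sites that keep every configuration in its component. -/
def componentStabilizer (φ : S × S → S × S → Prop) (E : X → X → Prop) :
    Subgroup (Equiv.Perm X) where
  carrier := {σ | ∀ η : X → S, EqvGen (PhiE φ E) (η ∘ σ) η}
  one_mem' η := EqvGen.refl _
  mul_mem' {σ τ} hσ hτ η := (hτ (η ∘ σ)).trans _ _ _ (hσ η)
  inv_mem' {σ} hσ η := by
    have h := (hσ (η ∘ ⇑σ⁻¹)).symm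
    have hη : (η ∘ ⇑σ⁻¹) ∘ ⇑σ = η := by
      funext x
      simp
    rwa [hη] at h

lemma swap_mem_componentStabilizer [DecidableEq X] (hex : Exchangeable φ) {x y : X}
    (hxy : E x y) (hne : x ≠ y) : Equiv.swap x y ∈ componentStabilizer φ E := by
  intro η
  have h := eqvGen_update_of_eqvGen hxy hne η (hex (η y) (η x))
  have h₁ : Function.update (Function.update η x (η y)) y (η x) = η ∘ Equiv.swap x y := by
    funext z
    by_cases hzy : z = y
    · simp [hzy]
    · by_cases hzx : z = x
      · simp [hzx, hne]
      · simp [hzx, hzy, Equiv.swap_apply_of_ne_of_ne]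
  have h₂ : Function.update (Function.update η x (η x)) y (η y) = η := by simp
  rw [← h₁]
  simpa only [h₂] using h

lemma componentStabilizer_eq_top [Finite X] (hex : Exchangeable φ) (hirr : Irreflexive E)
    (hconn : IsConnectedDigraph E) : componentStabilizer φ E = ⊤ := by
  classical
  have hswap (x y : X) : Equiv.swap x y ∈ componentStabilizer φ E := by
    induction hconn.2 x y with
    | refl => rw [Equiv.swap_self]; exact Subgroup.one_mem _
    | @tail b c _ hbc ih =>
      refine SubmonoidClass.swap_mem_trans _ ih (swap_mem_componentStabilizer hex hbc ?_)
      rintro rfl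
      exact hirr _ hbc
  rw [eq_top_iff, ← Equiv.Perm.closure_isSwap, Subgroup.closure_le]
  rintro _ ⟨x, y, -, rfl⟩
  exact hswap x y

variable [Fintype X]

lemma exists_perm_of_map_univ_eq {η η' : X → S}
    (h : Finset.univ.val.map η = Finset.univ.val.map η') : ∃ σ : Equiv.Perm X, η = η' ∘ σ := by
  classical
  have hcard (i : S) : Fintype.card {x // η x = i} = Fintype.card {x // η' x = i} := by
    have hcount := congrArg (Multiset.count i) h
    rw [Multiset.count_map, Multiset.count_map] at hcount
    rw [Fintype.card_subtype, Fintype.card_subtype]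
    simp only [eq_comm (a := i)] at hcount
    exact hcount
  refine ⟨Equiv.ofFiberEquiv fun i => Fintype.equivOfCardEq (hcard i), funext fun x => ?_⟩
  exact (Equiv.ofFiberEquiv_map _ x).symm

lemma eqvGen_of_map_univ_eq (htop : componentStabilizer φ E = ⊤) {η η' : X → S}
    (h : Finset.univ.val.map η = Finset.univ.val.map η') : EqvGen (PhiE φ E) η η' := by
  obtain ⟨σ, rfl⟩ := exists_perm_of_map_univ_eq h
  have hσ : σ ∈ componentStabilizer φ E := htop ▸ Subgroup.mem_top σ
  exact hσ η'

lemma exists_map_univ_eq {a : Multiset S} (ha : a.card = Fintype.card X) :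
    ∃ η : X → S, Finset.univ.val.map η = a := by
  induction a using Quotient.inductionOn with
  | h l =>
    have hl : Fintype.card X = l.length := ha.symm
    let e : X ≃ Fin l.length := Fintype.equivFinOfCardEq hl
    refine ⟨fun x => l.get (e x), ?_⟩
    have he : Finset.univ.val.map (fun x => l.get (e x)) =
        (Finset.univ.val.map e).map l.get := (Multiset.map_map _ _ _).symm
    have hu : Finset.univ.val.map e = (Finset.univ : Finset (Fin l.length)).val := by
      simp
    rw [he, hu, Fin.univ_val_map]
    simp

lemma exists_map_univ_eq_of_ne {x y : X} (hne : x ≠ y) {i j : S} {m : Multiset S}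
    (hm : ({i, j} + m).card = Fintype.card X) (k l : S) :
    ∃ η η' : X → S, Finset.univ.val.map η = {i, j} + m ∧ Finset.univ.val.map η' = {k, l} + m ∧
      η x = i ∧ η y = j ∧ η' x = k ∧ η' y = l ∧ ∀ z, z ≠ x → z ≠ y → η z = η' z := by
  classical
  let Y := {z : X // z ≠ x ∧ z ≠ y}
  have huniv : (Finset.univ : Finset X).val =
      x ::ₘ y ::ₘ (Finset.univ : Finset Y).val.map Subtype.val := by
    refine (Multiset.Nodup.ext Finset.univ.nodup ?_).mpr fun z => ?_
    · simp only [Multiset.nodup_cons]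
      refine ⟨by simp [hne, Y], by simp [Y], ?_⟩
      exact Finset.univ.nodup.map Subtype.val_injective
    · by_cases hzx : z = x <;> by_cases hzy : z = y <;> simp [hzx, hzy, Y]
  have hcard : m.card = Fintype.card Y := by
    have h := congrArg Multiset.card huniv
    rw [Multiset.card_cons, Multiset.card_cons, Multiset.card_map] at h
    change Fintype.card X = Fintype.card Y + 1 + 1 at h
    rw [Multiset.card_add, Multiset.card_pair] at hm
    omega
  obtain ⟨ζ, hζ⟩ := exists_map_univ_eq hcard
  have hmap (s t : S) : ∃ θ : X → S, Finset.univ.val.map θ = {s, t} + m ∧ θ x = s ∧ θ y = t ∧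
      ∀ z : Y, θ z = ζ z := by
    let θ : X → S := fun z => if h : z ≠ x ∧ z ≠ y then ζ ⟨z, h⟩ else if z = x then s else t
    have hθx : θ x = s := by simp [θ]
    have hθy : θ y = t := by simp [θ, hne.symm]
    have hθ (z : Y) : θ z = ζ z := dif_pos z.2
    refine ⟨θ, ?_, hθx, hθy, hθ⟩
    rw [huniv, Multiset.map_cons, Multiset.map_cons, Multiset.map_map, hθx, hθy, ← hζ]
    simp [hθ, Multiset.insert_eq_cons, Multiset.cons_add]
  obtain ⟨η, h, hx, hy, hz⟩ := hmap i j
  obtain ⟨η', h', hx', hy', hz'⟩ := hmap k l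
  exact ⟨η, η', h, h', hx, hy, hx', hy', fun z hzx hzy =>
    (hz ⟨z, hzx, hzy⟩).trans (hz' ⟨z, hzx, hzy⟩).symm⟩

lemma exists_edge_of_one_lt_card (hirr : Irreflexive E) (hconn : IsConnectedDigraph E)
    (hcard : 1 < Fintype.card X) : ∃ x y, E x y ∧ x ≠ y := by
  obtain ⟨x, y, hne⟩ := Fintype.exists_pair_of_one_lt_card hcard
  rcases (hconn.2 x y).cases_head with h | ⟨z, hxz, -⟩
  · exact absurd h hne
  · refine ⟨x, z, hxz, ?_⟩
    rintro rfl
    exact hirr _ hxz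

lemma eqvGen_of_rel (htop : componentStabilizer φ E = ⊤) (hirr : Irreflexive E)
    (hconn : IsConnectedDigraph E) {i j k l : S} (h : φ (i, j) (k, l)) {m : Multiset S}
    {η η' : X → S} (hη : Finset.univ.val.map η = {i, j} + m)
    (hη' : Finset.univ.val.map η' = {k, l} + m) : EqvGen (PhiE φ E) η η' := by
  have hcard : ({i, j} + m).card = Fintype.card X := by
    rw [← hη, Multiset.card_map, Finset.card_val, Finset.card_univ]
  obtain ⟨x, y, hxy, hne⟩ := exists_edge_of_one_lt_card hirr hconn (by
    rw [← hcard, Multiset.card_add, Multiset.card_pair]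
    omega)
  obtain ⟨ζ, ζ', hζ, hζ', hx, hy, hx', hy', hz⟩ := exists_map_univ_eq_of_ne hne hcard k l
  refine (eqvGen_of_map_univ_eq htop (hη.trans hζ.symm)).trans _ _ _
    (EqvGen.trans _ _ _ (EqvGen.rel _ _ ⟨x, y, hxy, ?_, hz⟩)
      (eqvGen_of_map_univ_eq htop (hζ'.trans hη'.symm)))
  rwa [hx, hy, hx', hy']

/-- The congruence identifying two words of the same length when exchanging their letters inside a
configuration does not change its component. -/
def configurationCon (htop : componentStabilizer φ E = ⊤) : Con (FreeSemigroup S) where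
  r v w := (letters v).toAdd.card = (letters w).toAdd.card ∧
    ∀ (m : Multiset S) (η η' : X → S), Finset.univ.val.map η = (letters v).toAdd + m →
      Finset.univ.val.map η' = (letters w).toAdd + m → EqvGen (PhiE φ E) η η'
  iseqv :=
    { refl := fun _ => ⟨rfl, fun _ _ _ h h' => eqvGen_of_map_univ_eq htop (h.trans h'.symm)⟩
      symm := fun h => ⟨h.1.symm, fun m η η' hη hη' => (h.2 m η' η hη' hη).symm⟩
      trans := by
        rintro u v w ⟨hc, h⟩ ⟨hc', h'⟩
        refine ⟨hc.trans hc', fun m η η' hη hη' => ?_⟩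
        obtain ⟨ζ, hζ⟩ := exists_map_univ_eq (X := X) (a := (letters v).toAdd + m) (by
          have := congrArg Multiset.card hη
          simp at this
          simp
          omega)
        exact (h m η ζ hη hζ).trans _ _ _ (h' m ζ η' hζ hη') }
  mul' := by
    rintro v v' w w' ⟨hc, h⟩ ⟨hc', h'⟩
    simp only [letters_mul]
    refine ⟨by simp only [Multiset.card_add, hc, hc'], fun m η η' hη hη' => ?_⟩
    obtain ⟨ζ, hζ⟩ := exists_map_univ_eq (X := X)
      (a := (letters v').toAdd + ((letters w).toAdd + m)) (by
        have := congrArg Multiset.card hη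
        simp at this
        simp
        omega)
    refine (h _ η ζ (by rw [hη, add_assoc]) hζ).trans _ _ _
      (h' ((letters v').toAdd + m) ζ η' (by rw [hζ]; abel) (by rw [hη']; abel))

end Configurations

section InteractionSemigroup

variable {n : ℕ} {φ : (Fin n × Fin n) → (Fin n × Fin n) → Prop}

lemma genM_mul_genM_of_rel {i j k l : Fin n} (h : φ (i, j) (k, l)) :
    genM φ i * genM φ j = genM φ k * genM φ l :=
  (Con.eq _).mpr (ConGen.Rel.of _ _ ⟨i, j, k, l, h, rfl, rfl⟩)

lemma genM_mul_genM_of_eqvGen {p q : Fin n × Fin n} (h : EqvGen φ p q) :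
    genM φ p.1 * genM φ p.2 = genM φ q.1 * genM φ q.2 := by
  induction h with
  | rel p q h => exact genM_mul_genM_of_rel h
  | refl p => rfl
  | symm p q _ ih => exact ih.symm
  | trans p q r _ _ ih ih' => exact ih.trans ih'

lemma interactionSemigroup_mul_comm (hex : Exchangeable φ) (a b : InteractionSemigroup φ) :
    a * b = b * a := by
  have hgen (i : Fin n) (w : FreeSemigroup (Fin n)) :
      Commute (genM φ i) (w : InteractionSemigroup φ) := by
    induction w using FreeSemigroup.recOnMul with
    | ih1 j => exact genM_mul_genM_of_eqvGen (hex i j)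
    | ih2 j w hj hw => rw [Con.coe_mul]; exact hj.mul_right hw
  induction a using Con.induction_on with
  | H v =>
    induction b using Con.induction_on with
    | H w =>
      change Commute (v : InteractionSemigroup φ) w
      induction v using FreeSemigroup.recOnMul with
      | ih1 i => exact hgen i w
      | ih2 i v hi hv => rw [Con.coe_mul]; exact hi.mul_left hv

/-- The semigroup of an exchangeable interaction is commutative. -/
abbrev interactionCommSemigroup (hex : Exchangeable φ) :
    CommSemigroup (InteractionSemigroup φ) where
  mul_comm := interactionSemigroup_mul_comm hex

lemma multisetEval_letters (hex : Exchangeable φ) (w : FreeSemigroup (Fin n)) :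
    letI := interactionCommSemigroup hex
    multisetEval (genM φ) (letters w).toAdd = ((w : InteractionSemigroup φ) : WithOne _) := by
  let := interactionCommSemigroup hex
  induction w using FreeSemigroup.recOnMul with
  | ih1 i => simp [letters_of, multisetEval, genM]
  | ih2 i w hi hw => rw [letters_mul, multisetEval_add, hi, hw, Con.coe_mul, WithOne.coe_mul]

end InteractionSemigroup

/-- If `(S, φ)` is an exchangeable interaction such that the semigroup `M(S, φ)` is
cancellative and power-cancellative, then `(S, φ)` is irreducibly quantified. -/
theorem cancellative_implies_irreduciblyQuantified {n : ℕ}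
    (φ : (Fin n × Fin n) → (Fin n × Fin n) → Prop) (hsymm : Symmetric φ)
    (hex : Exchangeable φ)
    (hcanc : ∀ a b c : InteractionSemigroup φ, c * a = c * b → a = b)
    (hpow : ∀ (a b : InteractionSemigroup φ) (N : ℕ), spow a N = spow b N → a = b) :
    IrreduciblyQuantified φ := by
  intro X _ E _ hirr hconn η η' hη
  have htop := componentStabilizer_eq_top hex hirr hconn
  have hne (θ : X → Fin n) : Finset.univ.val.map θ ≠ 0 := by
    have := hconn.1
    simp [Finset.univ_nonempty.ne_empty]
  obtain ⟨v, hv⟩ := exists_letters_eq (hne η)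
  obtain ⟨w, hw⟩ := exists_letters_eq (hne η')
  let := interactionCommSemigroup hex
  have hvw : (v : InteractionSemigroup φ) = w := by
    refine eq_of_forall_invariant hcanc hpow (genM φ) (multisetEval_letters hex v)
      (multisetEval_letters hex w) fun ξ hξ => ?_
    have hcons : IsConserved φ fun i => (ξ i : ℝ) := by
      intro s t s' t' h
      have hst := hξ {s, t} {s', t'} (by
        have := congrArg (WithOne.coe) (genM_mul_genM_of_rel h)
        simpa [multisetEval] using this)
      simp only [Multiset.insert_eq_cons, Multiset.map_cons, Multiset.map_singleton,
        Multiset.sum_cons, Multiset.sum_singleton] at hst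
      change (ξ s : ℝ) + ξ t = ξ s' + ξ t'
      exact_mod_cast hst
    have hsum := hη _ hcons
    rw [hv, hw, Multiset.map_map, Multiset.map_map]
    exact_mod_cast hsum
  have hle : interactionCon φ ≤ configurationCon (X := X) htop := by
    refine Con.conGen_le.mpr ?_
    rintro _ _ ⟨i, j, k, l, h, rfl, rfl⟩
    have hpair (s t : Fin n) :
        (letters (FreeSemigroup.of s * FreeSemigroup.of t)).toAdd = {s, t} := by
      rw [letters_mul, letters_of, letters_of]
      rfl
    refine ⟨by rw [hpair, hpair, Multiset.card_pair, Multiset.card_pair], fun m θ θ' hθ hθ' => ?_⟩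
    rw [hpair] at hθ hθ'
    exact eqvGen_of_rel htop hirr hconn h hθ hθ'
  exact (hle ((Con.eq _).mp hvw)).2 0 η η' (by rw [hv, add_zero]) (by rw [hw, add_zero])
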